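/- Let k be a positive integer with k ≡ 2 (mod 4). Then the map sending φ ∈ J_{k,1}(O_K) to its theta component h_{0,1} (the component at s = i/2) is an isomorphism of ℂ-vector spaces J_{k,1}(O_K) ≅ M_{k-1}(SL(2,ℤ), ω̄). -/

import Mathlib

noncomputable section

open Complex

/-- `τ` lies in the upper half plane. -/
def UHP (τ : ℂ) : Prop := 0 < τ.im

/-- `eC w = exp(2 π i w)`. -/
def eC (w : ℂ) : ℂ := Complex.exp (2 * (Real.pi : ℂ) * Complex.I * w)

/-- Entries of a matrix in `SL(2, ℤ)`, as complex numbers. -/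
def Ma (M : Matrix.SpecialLinearGroup (Fin 2) ℤ) : ℂ := ((M.1 0 0 : ℤ) : ℂ)
def Mb (M : Matrix.SpecialLinearGroup (Fin 2) ℤ) : ℂ := ((M.1 0 1 : ℤ) : ℂ)
def Mc (M : Matrix.SpecialLinearGroup (Fin 2) ℤ) : ℂ := ((M.1 1 0 : ℤ) : ℂ)
def Md (M : Matrix.SpecialLinearGroup (Fin 2) ℤ) : ℂ := ((M.1 1 1 : ℤ) : ℂ)

/-- Hermitian Jacobi form of weight `k` and index `m` for the Hermitian Jacobi group over
`ℤ[i]`.  A form is a function `φ : ℂ → ℂ → ℂ → ℂ`, all conditions being imposed for `τ`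
in the upper half plane.  Units `ε ∈ ℤ[i]ˣ = {1, -1, i, -i}`, and the elliptic variables
`λ = p + q i`, `μ = u + v i` range over `ℤ[i]`.  The Fourier expansion is indexed by
`n ∈ ℕ` and `r = (a + b i)/2 ∈ O_K^♯ = (i/2)ℤ[i]`, supported on `N(r) ≤ n m`,
i.e. `a² + b² ≤ 4 n m`. -/
structure IsHJF (k m : ℕ) (φ : ℂ → ℂ → ℂ → ℂ) : Prop where
  holo : DifferentiableOn ℂ (fun p : ℂ × ℂ × ℂ => φ p.1 p.2.1 p.2.2) {p | UHP p.1}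
  transf : ∀ ε : ℂ, ε ∈ ({1, -1, Complex.I, -Complex.I} : Set ℂ) →
    ∀ M : Matrix.SpecialLinearGroup (Fin 2) ℤ, ∀ τ z₁ z₂ : ℂ, UHP τ →
      φ ((Ma M * τ + Mb M) / (Mc M * τ + Md M))
        (ε * z₁ / (Mc M * τ + Md M))
        ((starRingEnd ℂ) ε * z₂ / (Mc M * τ + Md M))
      = ε ^ k * (Mc M * τ + Md M) ^ k *
          eC ((m : ℂ) * Mc M * z₁ * z₂ / (Mc M * τ + Md M)) * φ τ z₁ z₂
  ellip : ∀ p q u v : ℤ, ∀ τ z₁ z₂ : ℂ, UHP τ →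
      φ τ (z₁ + ((p : ℂ) + (q : ℂ) * Complex.I) * τ + ((u : ℂ) + (v : ℂ) * Complex.I))
          (z₂ + ((p : ℂ) - (q : ℂ) * Complex.I) * τ + ((u : ℂ) - (v : ℂ) * Complex.I))
      = eC (-(m : ℂ) * (((p : ℂ) ^ 2 + (q : ℂ) ^ 2) * τ
          + ((p : ℂ) - (q : ℂ) * Complex.I) * z₁
          + ((p : ℂ) + (q : ℂ) * Complex.I) * z₂)) * φ τ z₁ z₂
  fourier : ∃ c : ℕ → ℤ → ℤ → ℂ,
      (∀ (n : ℕ) (a b : ℤ), 4 * (n : ℤ) * m < a ^ 2 + b ^ 2 → c n a b = 0) ∧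
      ∀ τ z₁ z₂ : ℂ, UHP τ →
        HasSum (fun p : ℕ × ℤ × ℤ => c p.1 p.2.1 p.2.2 *
          eC ((p.1 : ℂ) * τ + (((p.2.1 : ℂ) + (p.2.2 : ℂ) * Complex.I) / 2) * z₁
            + (((p.2.1 : ℂ) - (p.2.2 : ℂ) * Complex.I) / 2) * z₂)) (φ τ z₁ z₂)

/-- Classical Jacobi form of weight `k` and index `m` for `SL(2,ℤ) ⋉ ℤ²`. -/
structure IsJF (k m : ℕ) (φ : ℂ → ℂ → ℂ) : Prop where
  holo : DifferentiableOn ℂ (fun p : ℂ × ℂ => φ p.1 p.2) {p | UHP p.1}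
  transf : ∀ M : Matrix.SpecialLinearGroup (Fin 2) ℤ, ∀ τ z : ℂ, UHP τ →
      φ ((Ma M * τ + Mb M) / (Mc M * τ + Md M)) (z / (Mc M * τ + Md M))
      = (Mc M * τ + Md M) ^ k *
          eC ((m : ℂ) * Mc M * z ^ 2 / (Mc M * τ + Md M)) * φ τ z
  ellip : ∀ p q : ℤ, ∀ τ z : ℂ, UHP τ →
      φ τ (z + (p : ℂ) * τ + (q : ℂ))
      = eC (-(m : ℂ) * ((p : ℂ) ^ 2 * τ + 2 * (p : ℂ) * z)) * φ τ z
  fourier : ∃ c : ℕ → ℤ → ℂ,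
      (∀ (n : ℕ) (r : ℤ), 4 * (n : ℤ) * m < r ^ 2 → c n r = 0) ∧
      ∀ τ z : ℂ, UHP τ →
        HasSum (fun p : ℕ × ℤ => c p.1 p.2 * eC ((p.1 : ℂ) * τ + (p.2 : ℂ) * z)) (φ τ z)

/-- Modular form of weight `k` for `SL(2,ℤ)`. -/
structure IsMF (k : ℕ) (f : ℂ → ℂ) : Prop where
  holo : DifferentiableOn ℂ f {τ | UHP τ}
  transf : ∀ M : Matrix.SpecialLinearGroup (Fin 2) ℤ, ∀ τ : ℂ, UHP τ →
      f ((Ma M * τ + Mb M) / (Mc M * τ + Md M)) = (Mc M * τ + Md M) ^ k * f τ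
  bounded : ∃ A B : ℝ, ∀ τ : ℂ, B ≤ τ.im → ‖f τ‖ ≤ A

/-- Cusp form of weight `k` for `SL(2,ℤ)`. -/
structure IsCF (k : ℕ) (f : ℂ → ℂ) : Prop where
  holo : DifferentiableOn ℂ f {τ | UHP τ}
  transf : ∀ M : Matrix.SpecialLinearGroup (Fin 2) ℤ, ∀ τ : ℂ, UHP τ →
      f ((Ma M * τ + Mb M) / (Mc M * τ + Md M)) = (Mc M * τ + Md M) ^ k * f τ
  decay : ∀ ε : ℝ, 0 < ε → ∃ B : ℝ, ∀ τ : ℂ, B ≤ τ.im → ‖f τ‖ ≤ ε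

/-- `M_w(SL(2,ℤ), ω̄)` for the character `ω` of `SL(2,ℤ)` with `ω(T) = ω(S) = i`:
holomorphic functions on the upper half plane, bounded at infinity, with
`f|_w T = -i f` and `f|_w S = -i f`. -/
structure IsMFOmegaBar (w : ℕ) (f : ℂ → ℂ) : Prop where
  holo : DifferentiableOn ℂ f {τ | UHP τ}
  transT : ∀ τ : ℂ, UHP τ → f (τ + 1) = -Complex.I * f τ
  transS : ∀ τ : ℂ, UHP τ → f (-1 / τ) = -Complex.I * τ ^ w * f τ
  bounded : ∃ A B : ℝ, ∀ τ : ℂ, B ≤ τ.im → ‖f τ‖ ≤ A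

/-- Hermitian theta function `θ^H_{m,s}` of index `m` with characteristic
`s = (a + b i)/2 ∈ O_K^♯`; the sum is over `r = s + m (g₁ + g₂ i) ∈ s + m ℤ[i]`. -/
def thetaH (m : ℕ) (a b : ℤ) (τ z₁ z₂ : ℂ) : ℂ :=
  ∑' g : ℤ × ℤ,
    eC ((((a : ℂ) + 2 * m * g.1) ^ 2 + ((b : ℂ) + 2 * m * g.2) ^ 2) / (4 * m) * τ
      + (((a : ℂ) + 2 * m * g.1) + ((b : ℂ) + 2 * m * g.2) * Complex.I) / 2 * z₁
      + (((a : ℂ) + 2 * m * g.1) - ((b : ℂ) + 2 * m * g.2) * Complex.I) / 2 * z₂)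

/-- Classical theta function `θ_{m,μ}(τ,z) = Σ_{r ≡ μ mod 2m} e(r²τ/(4m) + r z)`. -/
def thetaJ (m : ℕ) (μ : ℤ) (τ z : ℂ) : ℂ :=
  ∑' g : ℤ, eC (((μ : ℂ) + 2 * m * g) ^ 2 / (4 * m) * τ + ((μ : ℂ) + 2 * m * g) * z)

/-- `h` is the family of theta components of `φ` (for index `m`): the `h_{a,b}` depend
only on `(a, b) mod 2m` and `φ = Σ_{s ∈ O_K^♯ / m O_K} h_s θ^H_{m,s}`. -/
def HasThetaDecomp (m : ℕ) (φ : ℂ → ℂ → ℂ → ℂ) (h : ℤ → ℤ → ℂ → ℂ) : Prop :=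
  (∀ (a b : ℤ) (τ : ℂ), h (a + 2 * m) b τ = h a b τ ∧ h a (b + 2 * m) τ = h a b τ) ∧
  ∀ τ z₁ z₂ : ℂ, UHP τ →
    φ τ z₁ z₂ = ∑ a ∈ Finset.range (2 * m), ∑ b ∈ Finset.range (2 * m),
      h (a : ℤ) (b : ℤ) τ * thetaH m (a : ℤ) (b : ℤ) τ z₁ z₂

/-- `ϑ₀(τ) = Σ_{r ∈ ℤ} e(r² τ)`. -/
def theta0C (τ : ℂ) : ℂ := ∑' r : ℤ, eC ((r : ℂ) ^ 2 * τ)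

/-- `ϑ₁(τ) = Σ_{r odd} e(r² τ / 4)`. -/
def theta1C (τ : ℂ) : ℂ := ∑' r : ℤ, eC ((2 * (r : ℂ) + 1) ^ 2 * τ / 4)

/-- `ξ = ϑ₁ ϑ₀' − ϑ₀ ϑ₁'`. -/
def xiC (τ : ℂ) : ℂ := theta1C τ * deriv theta0C τ - theta0C τ * deriv theta1C τ

/-- Taylor coefficient `χ_{α,β}(τ)` of `φ(τ, z₁, z₂)` around `z₁ = z₂ = 0`. -/
def chiHJF (φ : ℂ → ℂ → ℂ → ℂ) (α β : ℕ) (τ : ℂ) : ℂ :=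
  (1 / ((α.factorial : ℂ) * (β.factorial : ℂ))) *
    iteratedDeriv α (fun z₁ => iteratedDeriv β (fun z₂ => φ τ z₁ z₂) 0) 0

/-- `D₀ : J_{k,m} → M_k`, `ψ ↦ ψ(·, 0)`. -/
def D0J (ψ : ℂ → ℂ → ℂ) : ℂ → ℂ := fun τ => ψ τ 0

/-- `D₂ : J_{k,m} → S_{k+2}`, `D₂ψ = (2k/(2πi)²) ψ₂ − (2m/(2πi)) ψ₀'`, where `ψ_ν` are
the Taylor coefficients of `ψ` around `z = 0`. -/
def D2J (k m : ℕ) (ψ : ℂ → ℂ → ℂ) : ℂ → ℂ := fun τ =>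
  (2 * (k : ℂ) / (2 * (Real.pi : ℂ) * Complex.I) ^ 2) *
      ((1 / 2) * iteratedDeriv 2 (fun z => ψ τ z) 0)
    - (2 * (m : ℂ) / (2 * (Real.pi : ℂ) * Complex.I)) * deriv (fun t => ψ t 0) τ

/-- Normalized Eisenstein series `E₄`. -/
def E4C (τ : ℂ) : ℂ :=
  1 + 240 * ∑' n : ℕ, ((ArithmeticFunction.sigma 3) n : ℂ) * eC ((n : ℂ) * τ)

/-- Normalized Eisenstein series `E₆`. -/
def E6C (τ : ℂ) : ℂ :=
  1 - 504 * ∑' n : ℕ, ((ArithmeticFunction.sigma 5) n : ℂ) * eC ((n : ℂ) * τ)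

/-- `f` agrees on the upper half plane with a polynomial in `E₄` and `E₆²` that is
homogeneous of weight `k - v`, i.e. supported on `4a + 12b + v = k`. -/
def IsE4E6sqPoly (v k : ℕ) (f : ℂ → ℂ) : Prop :=
  ∃ lam : ℕ × ℕ → ℂ, ∀ τ : ℂ, UHP τ →
    f τ = ∑ p ∈ (Finset.range (k + 1) ×ˢ Finset.range (k + 1)).filter
        (fun p => 4 * p.1 + 12 * p.2 + v = k),
      lam p * E4C τ ^ p.1 * E6C τ ^ (2 * p.2)

/-- The slash action `φ|_{k,m} M` of `M ∈ SL(2,ℤ)` on functions `ℂ → ℂ → ℂ → ℂ`. -/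
def slashHJF (k m : ℕ) (φ : ℂ → ℂ → ℂ → ℂ) (M : Matrix.SpecialLinearGroup (Fin 2) ℤ)
    (τ z₁ z₂ : ℂ) : ℂ :=
  ((Mc M * τ + Md M) ^ k)⁻¹ *
    eC (-(m : ℂ) * Mc M * z₁ * z₂ / (Mc M * τ + Md M)) *
    φ ((Ma M * τ + Mb M) / (Mc M * τ + Md M)) (z₁ / (Mc M * τ + Md M)) (z₂ / (Mc M * τ + Md M))

/-- Hermitian Jacobi form of weight `k` and index `m` for the congruence subgroup `Γ₀(N)`,
with at each cusp a Fourier expansion supported on `(n, r) ∈ ℚ_{≥0} × O_K^♯`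
with `N(r) ≤ n m`. -/
structure IsHJFLevel (k m N : ℕ) (φ : ℂ → ℂ → ℂ → ℂ) : Prop where
  holo : DifferentiableOn ℂ (fun p : ℂ × ℂ × ℂ => φ p.1 p.2.1 p.2.2) {p | UHP p.1}
  transf : ∀ ε : ℂ, ε ∈ ({1, -1, Complex.I, -Complex.I} : Set ℂ) →
    ∀ M : Matrix.SpecialLinearGroup (Fin 2) ℤ, (N : ℤ) ∣ M.1 1 0 →
    ∀ τ z₁ z₂ : ℂ, UHP τ →
      φ ((Ma M * τ + Mb M) / (Mc M * τ + Md M))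
        (ε * z₁ / (Mc M * τ + Md M))
        ((starRingEnd ℂ) ε * z₂ / (Mc M * τ + Md M))
      = ε ^ k * (Mc M * τ + Md M) ^ k *
          eC ((m : ℂ) * Mc M * z₁ * z₂ / (Mc M * τ + Md M)) * φ τ z₁ z₂
  ellip : ∀ p q u v : ℤ, ∀ τ z₁ z₂ : ℂ, UHP τ →
      φ τ (z₁ + ((p : ℂ) + (q : ℂ) * Complex.I) * τ + ((u : ℂ) + (v : ℂ) * Complex.I))
          (z₂ + ((p : ℂ) - (q : ℂ) * Complex.I) * τ + ((u : ℂ) - (v : ℂ) * Complex.I))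
      = eC (-(m : ℂ) * (((p : ℂ) ^ 2 + (q : ℂ) ^ 2) * τ
          + ((p : ℂ) - (q : ℂ) * Complex.I) * z₁
          + ((p : ℂ) + (q : ℂ) * Complex.I) * z₂)) * φ τ z₁ z₂
  cusp : ∀ M : Matrix.SpecialLinearGroup (Fin 2) ℤ,
      ∃ c : ℚ → ℤ → ℤ → ℂ,
        (∀ (n : ℚ) (a b : ℤ),
          ¬ (0 ≤ n ∧ ((a : ℚ) ^ 2 + (b : ℚ) ^ 2) ≤ 4 * n * m) → c n a b = 0) ∧
        ∀ τ z₁ z₂ : ℂ, UHP τ →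
          HasSum (fun p : ℚ × ℤ × ℤ => c p.1 p.2.1 p.2.2 *
            eC ((p.1 : ℂ) * τ + (((p.2.1 : ℂ) + (p.2.2 : ℂ) * Complex.I) / 2) * z₁
              + (((p.2.1 : ℂ) - (p.2.2 : ℂ) * Complex.I) / 2) * z₂))
            (slashHJF k m φ M τ z₁ z₂)

/-- Theta constant `x`. -/
def thConstX (τ : ℂ) : ℂ := ∑' n : ℤ, eC ((n : ℂ) ^ 2 * τ / 2)

/-- Theta constant `y`. -/
def thConstY (τ : ℂ) : ℂ := ∑' n : ℤ, (-1 : ℂ) ^ n * eC ((n : ℂ) ^ 2 * τ / 2)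

/-- Theta constant `z`. -/
def thConstZ (τ : ℂ) : ℂ := ∑' n : ℤ, eC (((n : ℂ) + 1 / 2) ^ 2 * τ / 2)


lemma eC_add (a b : ℂ) : eC (a + b) = eC a * eC b := by
  unfold eC; rw [← Complex.exp_add]; congr 1; ring

lemma eC_ne (a : ℂ) : eC a ≠ 0 := Complex.exp_ne_zero _

lemma eC_zero : eC 0 = 1 := by simp [eC]

lemma eC_neg (a : ℂ) : eC (-a) = (eC a)⁻¹ := by
  unfold eC; rw [← Complex.exp_neg]; congr 1; ring

lemma eC_int (n : ℤ) : eC n = 1 := by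
  unfold eC
  rw [Complex.exp_eq_one_iff]
  exact ⟨n, by ring⟩

lemma eC_congr {x y : ℂ} (n : ℤ) (h : x = y + n) : eC x = eC y := by
  rw [h, eC_add, eC_int, mul_one]

lemma eC_half : eC (1 / 2) = -1 := by
  unfold eC
  rw [← Complex.exp_pi_mul_I]; congr 1; ring

lemma eC_quarter : eC (1 / 4) = Complex.I := by
  unfold eC
  have := Complex.exp_pi_div_two_mul_I
  refine Eq.trans ?_ this
  congr 1; ring

lemma norm_eC (w : ℂ) : ‖eC w‖ = Real.exp (-2 * Real.pi * w.im) := by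
  unfold eC
  rw [Complex.norm_exp]
  congr 1
  simp

/-- one-variable theta -/
def tt (a : ℤ) (τ u : ℂ) : ℂ :=
  eC ((a : ℂ) ^ 2 / 4 * τ + a * u) * jacobiTheta₂ (2 * u + a * τ) (2 * τ)

lemma uhp2 {τ : ℂ} (h : UHP τ) : 0 < (2 * τ).im := by
  have : 0 < τ.im := h
  simpa using this

lemma tt_hasSum (a : ℤ) {τ : ℂ} (h : UHP τ) (u : ℂ) :
    HasSum (fun g : ℤ => eC (((a : ℂ) + 2 * g) ^ 2 / 4 * τ + ((a : ℂ) + 2 * g) * u)) (tt a τ u) := by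
  have := (hasSum_jacobiTheta₂_term (2 * u + a * τ) (uhp2 h)).mul_left
    (eC ((a : ℂ) ^ 2 / 4 * τ + a * u))
  refine this.congr_fun ?_
  intro g
  unfold eC jacobiTheta₂_term
  rw [← Complex.exp_add]; congr 1; ring

lemma tt_add_two (a p : ℤ) {τ : ℂ} (h : UHP τ) (u : ℂ) : tt (a + 2 * p) τ u = tt a τ u := by
  refine (tt_hasSum (a + 2 * p) h u).unique ?_
  refine ((Equiv.addRight p).hasSum_iff.mpr (tt_hasSum a h u)).congr_fun ?_
  intro g
  simp only [Function.comp, Equiv.coe_addRight]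
  congr 1; push_cast; ring

lemma tt_neg (a : ℤ) {τ : ℂ} (h : UHP τ) (u : ℂ) : tt a τ (-u) = tt a τ u := by
  refine (tt_hasSum a h (-u)).unique ?_
  refine ((Equiv.subLeft (-a)).hasSum_iff.mpr (tt_hasSum a h u)).congr_fun ?_
  intro g
  simp only [Function.comp, Equiv.subLeft_apply]
  congr 1; push_cast; ring

lemma tt_shift (a p v : ℤ) {τ : ℂ} (h : UHP τ) (u : ℂ) :
    tt a τ (u + p * τ + v) = eC (-((p : ℂ) ^ 2 * τ + 2 * p * u)) * tt a τ u := by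
  refine (tt_hasSum a h _).unique ?_
  refine ((Equiv.addRight p).hasSum_iff.mpr
    ((tt_hasSum a h u).mul_left (eC (-((p : ℂ) ^ 2 * τ + 2 * p * u))))).congr_fun ?_
  intro g
  simp only [Function.comp, Equiv.coe_addRight]
  rw [← eC_add]
  refine eC_congr ((a + 2 * g) * v) ?_
  push_cast; ring

lemma tt_half (a : ℤ) {τ : ℂ} (h : UHP τ) (u : ℂ) :
    tt a τ (u + 1 / 2) = eC (a / 2) * tt a τ u := by
  refine (tt_hasSum a h _).unique ?_
  refine ((tt_hasSum a h u).mul_left (eC (a / 2))).congr_fun ?_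
  intro g
  rw [← eC_add]
  refine eC_congr g ?_
  ring

lemma tt0_T {τ : ℂ} (h : UHP τ) (u : ℂ) : tt 0 (τ + 1) u = tt 0 τ u := by
  have h1 : UHP (τ + 1) := by simpa [UHP] using h
  refine (tt_hasSum 0 h1 _).unique ?_
  refine (tt_hasSum 0 h u).congr_fun ?_
  intro g
  refine eC_congr (g ^ 2) ?_
  push_cast; ring

lemma tt1_T {τ : ℂ} (h : UHP τ) (u : ℂ) : tt 1 (τ + 1) u = Complex.I * tt 1 τ u := by
  have h1 : UHP (τ + 1) := by simpa [UHP] using h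
  refine (tt_hasSum 1 h1 _).unique ?_
  refine ((tt_hasSum 1 h u).mul_left _).congr_fun ?_
  intro g
  rw [← eC_quarter, ← eC_add]
  refine eC_congr (g ^ 2 + g) ?_
  push_cast; ring

lemma tt_sum {τ : ℂ} (h : UHP τ) (u : ℂ) : jacobiTheta₂ u (τ / 2) = tt 0 τ u + tt 1 τ u := by
  have h2 : 0 < (τ / 2).im := by
    have : 0 < τ.im := h
    simpa using this
  refine (hasSum_jacobiTheta₂_term u h2).unique ?_
  have e : Function.Injective (fun g : ℤ => 2 * g) := fun a b h => by simpa using h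
  have o : Function.Injective (fun g : ℤ => 2 * g + 1) := fun a b h => by simpa using h
  have hcompl : IsCompl (Set.range (fun g : ℤ => 2 * g)) (Set.range (fun g : ℤ => 2 * g + 1)) := by
    have q1 : Set.range (fun g : ℤ => 2 * g) = {n | Even n} := by
      ext x; simp [even_iff_exists_two_mul, eq_comm]
    have q2 : Set.range (fun g : ℤ => 2 * g + 1) = {n | Odd n} := by
      ext x; simp [Odd, eq_comm]
    rw [q1, q2]
    exact Int.isCompl_even_odd
  have he := tt_hasSum 0 h u
  have ho := tt_hasSum 1 h u
  refine HasSum.add_isCompl (s := Set.range (fun g : ℤ => 2 * g))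
    (t := Set.range (fun g : ℤ => 2 * g + 1)) hcompl ?_ ?_
  · refine (e.hasSum_range_iff (f := fun n : ℤ => jacobiTheta₂_term n u (τ / 2))).mpr ?_
    refine he.congr_fun ?_
    intro g
    simp only [Function.comp, eC, jacobiTheta₂_term]
    congr 1; push_cast; ring
  · refine (o.hasSum_range_iff (f := fun n : ℤ => jacobiTheta₂_term n u (τ / 2))).mpr ?_
    refine ho.congr_fun ?_
    intro g
    simp only [Function.comp, eC, jacobiTheta₂_term]
    congr 1; push_cast; ring

lemma uhp_ne {τ : ℂ} (h : UHP τ) : τ ≠ 0 := by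
  rintro rfl; simp [UHP] at h

lemma uhp_S {τ : ℂ} (h : UHP τ) : UHP (-1 / τ) := by
  have h' : 0 < τ.im := h
  have : 0 < Complex.normSq τ := Complex.normSq_pos.mpr (uhp_ne h)
  unfold UHP
  rw [neg_div, Complex.neg_im, one_div, Complex.inv_im]
  rw [neg_div, neg_neg]; positivity

def rt (τ : ℂ) : ℂ := (-Complex.I * (τ / 2)) ^ (1 / 2 : ℂ)

lemma rt_sq {τ : ℂ} : rt τ * rt τ = -Complex.I * τ / 2 := by
  unfold rt
  rw [← pow_two]
  have := Complex.cpow_nat_inv_pow (-Complex.I * (τ / 2)) (n := 2) (by norm_num)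
  rw [one_div]
  push_cast at this
  rw [this]; ring

lemma rt_ne {τ : ℂ} (h : UHP τ) : rt τ ≠ 0 := by
  intro h0
  have := rt_sq (τ := τ)
  rw [h0] at this
  have h1 := uhp_ne h
  rw [zero_mul, eq_comm, neg_mul, neg_div, neg_eq_zero] at this
  simp [h1] at this

lemma tt0_S {τ : ℂ} (h : UHP τ) (u : ℂ) :
    tt 0 (-1 / τ) (u / τ) = rt τ * eC (u ^ 2 / τ) * (tt 0 τ u + tt 1 τ u) := by
  have h0 := uhp_ne h
  have hr := rt_ne h
  rw [← tt_sum h, jacobiTheta₂_functional_equation]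
  have e1 : u / (τ / 2) = 2 * (u / τ) := by field_simp
  have e2 : -1 / (τ / 2) = 2 * (-1 / τ) := by field_simp
  rw [e1, e2]
  change _ = rt τ * _ * (1 / rt τ * _ * _)
  have e3 : eC (u ^ 2 / τ) * cexp (-Real.pi * Complex.I * u ^ 2 / (τ / 2)) = 1 := by
    unfold eC
    rw [← Complex.exp_add, ← Complex.exp_zero]
    congr 1; field_simp; ring
  have e4 : tt 0 (-1 / τ) (u / τ) = jacobiTheta₂ (2 * (u / τ)) (2 * (-1 / τ)) := by
    simp [tt, eC_zero]
  rw [e4]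
  generalize jacobiTheta₂ (2 * (u / τ)) (2 * (-1 / τ)) = J at *
  generalize cexp (-Real.pi * Complex.I * u ^ 2 / (τ / 2)) = E at *
  have e5 : rt τ * (1 / rt τ) = 1 := by field_simp
  linear_combination (-J) * e3 - J * eC (u ^ 2 / τ) * E * e5

lemma tt1_S {τ : ℂ} (h : UHP τ) (u : ℂ) :
    tt 1 (-1 / τ) (u / τ) = rt τ * eC (u ^ 2 / τ) * (tt 0 τ u - tt 1 τ u) := by
  have h0 := uhp_ne h
  have key := tt0_S h (u - 1 / 2)
  have a0 := tt_half 0 h (u - 1 / 2)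
  have a1 := tt_half 1 h (u - 1 / 2)
  have s0 : eC (((0:ℤ):ℂ) / 2) = 1 := by simp [eC_zero]
  have s1 : eC (((1:ℤ):ℂ) / 2) = -1 := by rw [← eC_half]; simp
  rw [s0, sub_add_cancel, one_mul] at a0
  rw [s1, sub_add_cancel] at a1
  rw [← a0, show tt 1 τ (u - 1 / 2) = - tt 1 τ u by rw [a1]; ring] at key
  have e1 : tt 1 (-1 / τ) (u / τ) = eC (-1 / (4 * τ) + u / τ) * tt 0 (-1 / τ) ((u - 1 / 2) / τ) := by
    simp only [tt]
    have : (2 * (u / τ) + ((1:ℤ):ℂ) * (-1 / τ)) = 2 * ((u - 1 / 2) / τ) + ((0:ℤ):ℂ) * (-1 / τ) := by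
      push_cast; ring
    rw [this]
    have : eC (((0:ℤ):ℂ) ^ 2 / 4 * (-1 / τ) + ((0:ℤ):ℂ) * ((u - 1 / 2) / τ)) = 1 := by simp [eC_zero]
    rw [this]
    have : (((1:ℤ):ℂ) ^ 2 / 4 * (-1 / τ) + ((1:ℤ):ℂ) * (u / τ)) = -1 / (4 * τ) + u / τ := by
      push_cast; field_simp
    rw [this]; ring
  have e2 : eC (-1 / (4 * τ) + u / τ) * eC ((u - 1 / 2) ^ 2 / τ) = eC (u ^ 2 / τ) := by
    rw [← eC_add]; congr 1; field_simp; ring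
  rw [e1, key, ← e2]; ring

lemma tt_diff (a : ℤ) {τ : ℂ} (h : UHP τ) (u : ℂ) :
    DifferentiableAt ℂ (fun p : ℂ × ℂ => tt a p.1 p.2) (τ, u) := by
  unfold tt eC
  have hd := (hasFDerivAt_jacobiTheta₂ (2 * u + a * τ) (uhp2 h)).differentiableAt
  have : DifferentiableAt ℂ (fun p : ℂ × ℂ => ((2 * p.2 + a * p.1, 2 * p.1) : ℂ × ℂ)) (τ, u) := by
    fun_prop
  have h3 := DifferentiableAt.comp (x := ((τ, u) : ℂ × ℂ)) (f := fun p : ℂ × ℂ => ((2 * p.2 + a * p.1, 2 * p.1) : ℂ × ℂ)) (g := fun p : ℂ × ℂ => jacobiTheta₂ p.1 p.2) hd this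
  have h4 : DifferentiableAt ℂ (fun p : ℂ × ℂ => cexp (2 * (Real.pi : ℂ) * Complex.I * ((a:ℂ) ^ 2 / 4 * p.1 + a * p.2))) (τ, u) := by fun_prop
  exact h4.mul h3

lemma jt_ne {τ : ℂ} (h : 0 < τ.im) : ∃ z, jacobiTheta₂ z τ ≠ 0 := by
  by_contra! hz
  let f : ℤ → C(ℝ, ℂ) := fun n => ⟨fun x => jacobiTheta₂_term n x τ, by
    unfold jacobiTheta₂_term; fun_prop⟩
  have hs := (hasSum_jacobiTheta₂_term 0 h).summable.norm
  have key := intervalIntegral.hasSum_intervalIntegral_of_summable_norm (a := 0) (b := 1) (f := f) (by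
    refine Summable.of_nonneg_of_le (fun _ => norm_nonneg _) (fun n => ?_) hs
    rw [ContinuousMap.norm_le _ (norm_nonneg _)]
    rintro ⟨x, hx⟩
    simp [f, norm_jacobiTheta₂_term])
  have e0 : ∀ x : ℝ, ∑' i, f i x = 0 := fun x => hz x
  simp only [e0, intervalIntegral.integral_zero] at key
  have e1 : ∀ n : ℤ, ∫ x in (0:ℝ)..1, f n x = if n = 0 then 1 else 0 := by
    intro n
    simp only [f, ContinuousMap.coe_mk, jacobiTheta₂_term]
    split_ifs with hn
    · subst hn; simp
    · simp only [Complex.exp_add]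
      rw [intervalIntegral.integral_mul_const]
      have hc : (2 * (Real.pi : ℂ) * Complex.I * n) ≠ 0 := by
        simp [hn, Real.pi_ne_zero]
      rw [integral_exp_mul_complex hc]
      have : cexp (2 * (Real.pi : ℂ) * Complex.I * n * ((1:ℝ):ℂ)) = 1 := by
        rw [Complex.exp_eq_one_iff]; exact ⟨n, by push_cast; ring⟩
      rw [this]; simp
  simp only [e1] at key
  have := key.unique (hasSum_ite_eq (0:ℤ) (1:ℂ))
  simp at this

lemma tt_ne (a : ℤ) {τ : ℂ} (h : UHP τ) : ∃ u, tt a τ u ≠ 0 := by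
  obtain ⟨z, hz⟩ := jt_ne (uhp2 h)
  refine ⟨(z - a * τ) / 2, mul_ne_zero (eC_ne _) ?_⟩
  rwa [show 2 * ((z - a * τ) / 2) + a * τ = z by ring]

lemma thetaH_exp (a b τ z₁ z₂ x y : ℂ) :
    (a + 2 * x) ^ 2 / 4 * τ + (a + 2 * x) * ((z₁ + z₂) / 2)
      + ((b + 2 * y) ^ 2 / 4 * τ + (b + 2 * y) * (Complex.I * (z₁ - z₂) / 2))
    = (((a + 2 * ((1 : ℕ) : ℂ) * x) ^ 2 + (b + 2 * ((1 : ℕ) : ℂ) * y) ^ 2) / (4 * ((1 : ℕ) : ℂ)) * τ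
      + ((a + 2 * ((1 : ℕ) : ℂ) * x) + (b + 2 * ((1 : ℕ) : ℂ) * y) * Complex.I) / 2 * z₁
      + ((a + 2 * ((1 : ℕ) : ℂ) * x) - (b + 2 * ((1 : ℕ) : ℂ) * y) * Complex.I) / 2 * z₂) := by
  rw [Nat.cast_one]; ring

lemma hasSum_mulC {ι κ : Type} {F : ι → ℂ} {G : κ → ℂ} {A B : ℂ} (ha : HasSum F A)
    (hb : HasSum G B) : HasSum (fun g : ι × κ => F g.1 * G g.2) (A * B) := by
  have h := summable_mul_of_summable_norm ha.summable.norm hb.summable.norm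
  exact ha.mul hb h

lemma tt2_hasSum (a b : ℤ) {τ : ℂ} (h : UHP τ) (u v : ℂ) : HasSum (fun g : ℤ × ℤ =>
      eC (((a : ℂ) + 2 * g.1) ^ 2 / 4 * τ + ((a : ℂ) + 2 * g.1) * u) *
      eC (((b : ℂ) + 2 * g.2) ^ 2 / 4 * τ + ((b : ℂ) + 2 * g.2) * v))
      (tt a τ u * tt b τ v) := by
  have ha := tt_hasSum a h u
  have hb := tt_hasSum b h v
  have := hasSum_mulC ha hb
  exact this

lemma thetaH_eq (a b : ℤ) {τ : ℂ} (h : UHP τ) (z₁ z₂ : ℂ) :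
    thetaH 1 a b τ z₁ z₂ = tt a τ ((z₁ + z₂) / 2) * tt b τ (Complex.I * (z₁ - z₂) / 2) := by
  rw [← (tt2_hasSum a b h _ _).tsum_eq, thetaH]
  refine tsum_congr fun g => ?_
  rw [← eC_add, thetaH_exp]

/-- the basic combination -/
def Th (τ w₁ w₂ : ℂ) : ℂ := tt 0 τ w₁ * tt 1 τ w₂ - tt 1 τ w₁ * tt 0 τ w₂

lemma s0 : eC (((0:ℤ):ℂ) / 2) = 1 := by simp [eC_zero]
lemma s1 : eC (((1:ℤ):ℂ) / 2) = -1 := by rw [← eC_half]; simp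

lemma tt0_half {τ : ℂ} (h : UHP τ) (u : ℂ) : tt 0 τ (u + 1 / 2) = tt 0 τ u := by
  rw [tt_half 0 h, s0, one_mul]

lemma tt1_half {τ : ℂ} (h : UHP τ) (u : ℂ) : tt 1 τ (u + 1 / 2) = - tt 1 τ u := by
  rw [tt_half 1 h, s1]; ring

lemma lin_indep {τ : ℂ} (h : UHP τ) (c00 c01 c10 c11 : ℂ)
    (H : ∀ w₁ w₂, c00 * (tt 0 τ w₁ * tt 0 τ w₂) + c01 * (tt 0 τ w₁ * tt 1 τ w₂)
      + c10 * (tt 1 τ w₁ * tt 0 τ w₂) + c11 * (tt 1 τ w₁ * tt 1 τ w₂) = 0) :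
    c00 = 0 ∧ c01 = 0 ∧ c10 = 0 ∧ c11 = 0 := by
  obtain ⟨u0, h0⟩ := tt_ne 0 h
  obtain ⟨u1, h1⟩ := tt_ne 1 h
  have K : ∀ w₁ w₂, _ ∧ _ ∧ _ := fun w₁ w₂ =>
    ⟨H (w₁ + 1/2) w₂, H w₁ (w₂ + 1/2), H (w₁ + 1/2) (w₂ + 1/2)⟩
  simp only [tt0_half h, tt1_half h] at K
  refine ⟨?_, ?_, ?_, ?_⟩
  · have : c00 * (tt 0 τ u0 * tt 0 τ u0) = 0 := by
      obtain ⟨k1, k2, k3⟩ := K u0 u0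
      linear_combination (H u0 u0 + k1 + k2 + k3) / 4
    simpa [h0] using this
  · have : c01 * (tt 0 τ u0 * tt 1 τ u1) = 0 := by
      obtain ⟨k1, k2, k3⟩ := K u0 u1
      linear_combination (H u0 u1 + k1 - k2 - k3) / 4
    simpa [h0, h1] using this
  · have : c10 * (tt 1 τ u1 * tt 0 τ u0) = 0 := by
      obtain ⟨k1, k2, k3⟩ := K u1 u0
      linear_combination (H u1 u0 - k1 + k2 - k3) / 4
    simpa [h0, h1] using this
  · have : c11 * (tt 1 τ u1 * tt 1 τ u1) = 0 := by
      obtain ⟨k1, k2, k3⟩ := K u1 u1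
      linear_combination (H u1 u1 - k1 - k2 + k3) / 4
    simpa [h1] using this

lemma Th_ne {τ : ℂ} (h : UHP τ) : ∃ w₁ w₂, Th τ w₁ w₂ ≠ 0 := by
  by_contra! hz
  have := lin_indep h 0 1 (-1) 0 (fun w₁ w₂ => by
    have := hz w₁ w₂
    unfold Th at this
    linear_combination this)
  simp at this

lemma Th_T {τ : ℂ} (h : UHP τ) (w₁ w₂ : ℂ) : Th (τ + 1) w₁ w₂ = Complex.I * Th τ w₁ w₂ := by
  simp only [Th, tt0_T h, tt1_T h]; ring

lemma Th_S {τ : ℂ} (h : UHP τ) (w₁ w₂ : ℂ) : Th (-1 / τ) (w₁ / τ) (w₂ / τ)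
    = Complex.I * τ * eC ((w₁ ^ 2 + w₂ ^ 2) / τ) * Th τ w₁ w₂ := by
  simp only [Th, tt0_S h, tt1_S h]
  rw [add_div, eC_add]
  have := rt_sq (τ := τ)
  linear_combination (-2 * eC (w₁ ^ 2 / τ) * eC (w₂ ^ 2 / τ) * (tt 0 τ w₁ * tt 1 τ w₂ - tt 1 τ w₁ * tt 0 τ w₂)) * this

lemma Th_rot {τ : ℂ} (h : UHP τ) (w₁ w₂ : ℂ) : Th τ w₂ (-w₁) = - Th τ w₁ w₂ := by
  simp only [Th, tt_neg _ h]; ring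

lemma Th_neg {τ : ℂ} (h : UHP τ) (w₁ w₂ : ℂ) : Th τ (-w₁) (-w₂) = Th τ w₁ w₂ := by
  simp only [Th, tt_neg _ h]

lemma Th_shift (p q u v : ℤ) {τ : ℂ} (h : UHP τ) (w₁ w₂ : ℂ) :
    Th τ (w₁ + p * τ + u) (w₂ + q * τ + v)
      = eC (-(((p:ℂ) ^ 2 + (q:ℂ) ^ 2) * τ + 2 * p * w₁ + 2 * q * w₂)) * Th τ w₁ w₂ := by
  simp only [Th, tt_shift _ _ _ h]
  rw [show (-(((p:ℂ) ^ 2 + (q:ℂ) ^ 2) * τ + 2 * p * w₁ + 2 * q * w₂)) =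
    (-((p:ℂ) ^ 2 * τ + 2 * p * w₁)) + (-((q:ℂ) ^ 2 * τ + 2 * q * w₂)) by ring, eC_add]
  ring

lemma Th_diff {τ : ℂ} (h : UHP τ) (w₁ w₂ : ℂ) :
    DifferentiableAt ℂ (fun p : ℂ × ℂ × ℂ => Th p.1 p.2.1 p.2.2) (τ, w₁, w₂) := by
  have A : ∀ a : ℤ, DifferentiableAt ℂ (fun p : ℂ × ℂ × ℂ => tt a p.1 p.2.1) (τ, w₁, w₂) := fun a =>
    DifferentiableAt.comp (x := ((τ, w₁, w₂) : ℂ × ℂ × ℂ)) (f := fun p : ℂ × ℂ × ℂ => ((p.1, p.2.1) : ℂ × ℂ))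
      (g := fun p : ℂ × ℂ => tt a p.1 p.2) (tt_diff a h w₁) (by fun_prop)
  have B : ∀ a : ℤ, DifferentiableAt ℂ (fun p : ℂ × ℂ × ℂ => tt a p.1 p.2.2) (τ, w₁, w₂) := fun a =>
    DifferentiableAt.comp (x := ((τ, w₁, w₂) : ℂ × ℂ × ℂ)) (f := fun p : ℂ × ℂ × ℂ => ((p.1, p.2.2) : ℂ × ℂ))
      (g := fun p : ℂ × ℂ => tt a p.1 p.2) (tt_diff a h w₂) (by fun_prop)
  exact ((A 0).mul (B 1)).sub ((A 1).mul (B 0))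

/-- in original coordinates -/
def ThZ (τ z₁ z₂ : ℂ) : ℂ := Th τ ((z₁ + z₂) / 2) (Complex.I * (z₁ - z₂) / 2)

lemma ThZ_W (τ w₁ w₂ : ℂ) : ThZ τ (w₁ - Complex.I * w₂) (w₁ + Complex.I * w₂) = Th τ w₁ w₂ := by
  unfold ThZ
  congr 1
  · ring
  · linear_combination (-w₂) * Complex.I_mul_I

lemma ThZ_diff {τ : ℂ} (h : UHP τ) (z₁ z₂ : ℂ) :
    DifferentiableAt ℂ (fun p : ℂ × ℂ × ℂ => ThZ p.1 p.2.1 p.2.2) (τ, z₁, z₂) :=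
  DifferentiableAt.comp (x := ((τ, z₁, z₂) : ℂ × ℂ × ℂ))
    (f := fun p : ℂ × ℂ × ℂ => ((p.1, (p.2.1 + p.2.2) / 2, Complex.I * (p.2.1 - p.2.2) / 2) : ℂ × ℂ × ℂ))
    (g := fun p : ℂ × ℂ × ℂ => Th p.1 p.2.1 p.2.2) (Th_diff h _ _) (by fun_prop)

lemma ThZ_T {τ : ℂ} (h : UHP τ) (z₁ z₂ : ℂ) : ThZ (τ + 1) z₁ z₂ = Complex.I * ThZ τ z₁ z₂ :=
  Th_T h _ _

lemma ThZ_S {τ : ℂ} (h : UHP τ) (z₁ z₂ : ℂ) : ThZ (-1 / τ) (z₁ / τ) (z₂ / τ)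
    = Complex.I * τ * eC (z₁ * z₂ / τ) * ThZ τ z₁ z₂ := by
  unfold ThZ
  rw [show (z₁ / τ + z₂ / τ) / 2 = ((z₁ + z₂) / 2) / τ by ring,
    show Complex.I * (z₁ / τ - z₂ / τ) / 2 = (Complex.I * (z₁ - z₂) / 2) / τ by ring, Th_S h]
  congr 4
  linear_combination ((z₁ - z₂) ^ 2 / 4) * Complex.I_mul_I

lemma ThZ_rot {τ : ℂ} (h : UHP τ) (z₁ z₂ : ℂ) :
    ThZ τ (Complex.I * z₁) (-Complex.I * z₂) = - ThZ τ z₁ z₂ := by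
  unfold ThZ
  rw [← Th_rot h]
  congr 1
  · ring
  · linear_combination ((z₁ + z₂) / 2) * Complex.I_mul_I

lemma ThZ_neg {τ : ℂ} (h : UHP τ) (z₁ z₂ : ℂ) : ThZ τ (-z₁) (-z₂) = ThZ τ z₁ z₂ := by
  unfold ThZ
  rw [← Th_neg h]
  congr 1 <;> ring

lemma ThZ_ellip (p q u v : ℤ) {τ : ℂ} (h : UHP τ) (z₁ z₂ : ℂ) :
    ThZ τ (z₁ + ((p : ℂ) + (q : ℂ) * Complex.I) * τ + ((u : ℂ) + (v : ℂ) * Complex.I))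
          (z₂ + ((p : ℂ) - (q : ℂ) * Complex.I) * τ + ((u : ℂ) - (v : ℂ) * Complex.I))
      = eC (-(((p : ℂ) ^ 2 + (q : ℂ) ^ 2) * τ
          + ((p : ℂ) - (q : ℂ) * Complex.I) * z₁
          + ((p : ℂ) + (q : ℂ) * Complex.I) * z₂)) * ThZ τ z₁ z₂ := by
  unfold ThZ
  have := Th_shift p (-q) u (-v) h ((z₁ + z₂) / 2) (Complex.I * (z₁ - z₂) / 2)
  refine Eq.trans ?_ (this.trans ?_)
  · congr 1
    · ring
    · push_cast; linear_combination (q * τ + v) * Complex.I_mul_I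
  · congr 2
    push_cast; ring

/-- consequence of the decomposition and unit invariance -/
lemma decomp {k : ℕ} (hk4 : k % 4 = 2) {φ : ℂ → ℂ → ℂ → ℂ} {h : ℤ → ℤ → ℂ → ℂ}
    (hφ : IsHJF k 1 φ) (hd : HasThetaDecomp 1 φ h) {τ : ℂ} (hτ : UHP τ) (z₁ z₂ : ℂ) :
    φ τ z₁ z₂ = h 0 1 τ * ThZ τ z₁ z₂ := by
  have hdec : ∀ w₁ w₂, φ τ (w₁ - Complex.I * w₂) (w₁ + Complex.I * w₂) =
      h 0 0 τ * (tt 0 τ w₁ * tt 0 τ w₂) + h 0 1 τ * (tt 0 τ w₁ * tt 1 τ w₂)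
      + h 1 0 τ * (tt 1 τ w₁ * tt 0 τ w₂) + h 1 1 τ * (tt 1 τ w₁ * tt 1 τ w₂) := by
    intro w₁ w₂
    rw [hd.2 _ _ _ hτ]
    have e1 : (w₁ - Complex.I * w₂ + (w₁ + Complex.I * w₂)) / 2 = w₁ := by ring
    have e2 : Complex.I * (w₁ - Complex.I * w₂ - (w₁ + Complex.I * w₂)) / 2 = w₂ := by
      linear_combination (-w₂) * Complex.I_mul_I
    simp only [thetaH_eq _ _ hτ, e1, e2, Finset.sum_range_succ, Finset.sum_range_zero,
      mul_one, Nat.cast_zero, Nat.cast_one, zero_add]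
    ring
  have hrot : ∀ w₁ w₂, φ τ (w₂ + Complex.I * w₁) (w₂ - Complex.I * w₁)
      = - φ τ (w₁ - Complex.I * w₂) (w₁ + Complex.I * w₂) := by
    intro w₁ w₂
    have := hφ.transf Complex.I (by simp) 1 τ (w₁ - Complex.I * w₂) (w₁ + Complex.I * w₂) hτ
    have hk : Complex.I ^ k = -1 := by
      rw [← Nat.div_add_mod k 4, hk4, pow_add, pow_mul, Complex.I_pow_four]; simp
    simp only [Ma, Mb, Mc, Md, hk] at this
    simp [eC_zero] at this
    rw [← this]
    congr 1
    · linear_combination w₂ * Complex.I_mul_I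
    · linear_combination w₂ * Complex.I_mul_I
  obtain ⟨h00, h01, h10, h11⟩ := lin_indep hτ (2 * h 0 0 τ) (h 0 1 τ + h 1 0 τ) (h 0 1 τ + h 1 0 τ) (2 * h 1 1 τ) (by
    intro w₁ w₂
    have h1 := hdec w₁ w₂
    have h2 := hdec w₂ (-w₁)
    rw [show w₂ - Complex.I * -w₁ = w₂ + Complex.I * w₁ by ring,
      show w₂ + Complex.I * -w₁ = w₂ - Complex.I * w₁ by ring, hrot, h1] at h2
    simp only [tt_neg _ hτ] at h2
    linear_combination -h2)
  have := hdec ((z₁ + z₂) / 2) (Complex.I * (z₁ - z₂) / 2)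
  rw [show (z₁ + z₂) / 2 - Complex.I * (Complex.I * (z₁ - z₂) / 2) = z₁ by
      linear_combination (-(z₁ - z₂) / 2) * Complex.I_mul_I,
    show (z₁ + z₂) / 2 + Complex.I * (Complex.I * (z₁ - z₂) / 2) = z₂ by
      linear_combination ((z₁ - z₂) / 2) * Complex.I_mul_I] at this
  rw [this]
  unfold ThZ Th
  linear_combination (tt 0 τ ((z₁ + z₂) / 2) * tt 0 τ (Complex.I * (z₁ - z₂) / 2)) / 2 * h00
    + (tt 1 τ ((z₁ + z₂) / 2) * tt 0 τ (Complex.I * (z₁ - z₂) / 2)) * h01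
    + (tt 1 τ ((z₁ + z₂) / 2) * tt 1 τ (Complex.I * (z₁ - z₂) / 2)) / 2 * h11

lemma bd {ι : Type} (c : ι → ℂ) (n : ι → ℝ) (hn : ∀ i, c i ≠ 0 → 1 ≤ n i) (F : ℂ → ℂ)
    (hF : ∀ τ, UHP τ → HasSum (fun i => c i * eC ((n i : ℂ) * τ)) (F τ)) :
    ∃ C : ℝ, 0 ≤ C ∧ ∀ τ : ℂ, 1 ≤ τ.im → ‖F τ‖ ≤ C * Real.exp (-2 * Real.pi * τ.im) := by
  have hI : UHP Complex.I := by simp [UHP]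
  have hs := (hF Complex.I hI).summable.norm
  refine ⟨(∑' i, ‖c i * eC ((n i : ℂ) * Complex.I)‖) * Real.exp (2 * Real.pi),
    mul_nonneg (tsum_nonneg fun _ => norm_nonneg _) (Real.exp_pos _).le, fun τ hτ => ?_⟩
  have hu : UHP τ := by unfold UHP; linarith
  rw [← (hF τ hu).tsum_eq]
  rw [mul_assoc, ← tsum_mul_right]
  refine tsum_of_norm_bounded (hs.mul_right _).hasSum fun i => ?_
  by_cases h0 : c i = 0
  · simp [h0]
  have h1 := hn i h0
  rw [norm_mul, norm_mul, norm_eC, norm_eC, mul_assoc ‖c i‖, ← Real.exp_add, ← Real.exp_add]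
  refine mul_le_mul_of_nonneg_left (Real.exp_le_exp.mpr ?_) (norm_nonneg _)
  have e1 : ((n i : ℂ) * τ).im = n i * τ.im := by simp
  have e2 : ((n i : ℂ) * Complex.I).im = n i := by simp
  rw [e1, e2]
  have : 0 ≤ (n i - 1) * (τ.im - 1) := mul_nonneg (by linarith) (by linarith)
  nlinarith [Real.pi_pos]

lemma bd_phi {k : ℕ} {φ : ℂ → ℂ → ℂ → ℂ} (hφ : IsHJF k 1 φ) : ∃ c0 : ℂ, ∀ z₁ z₂,
    ∃ C : ℝ, 0 ≤ C ∧ ∀ τ : ℂ, 1 ≤ τ.im → ‖φ τ z₁ z₂ - c0‖ ≤ C * Real.exp (-2 * Real.pi * τ.im) := by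
  classical
  obtain ⟨c, hc, hs⟩ := hφ.fourier
  refine ⟨c 0 0 0, fun z₁ z₂ => ?_⟩
  refine bd (fun p : ℕ × ℤ × ℤ => if p = (0, 0, 0) then 0 else c p.1 p.2.1 p.2.2 *
      eC ((((p.2.1 : ℂ) + (p.2.2 : ℂ) * Complex.I) / 2) * z₁
            + (((p.2.1 : ℂ) - (p.2.2 : ℂ) * Complex.I) / 2) * z₂)) (fun p => (p.1 : ℝ)) ?_
    (fun τ => φ τ z₁ z₂ - c 0 0 0) ?_
  · rintro ⟨n, a, b⟩ hp
    rcases Nat.eq_zero_or_pos n with h0 | h0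
    · exfalso
      subst h0
      apply hp
      by_cases hab : a = 0 ∧ b = 0
      · simp [hab.1, hab.2]
      · have : 0 < a ^ 2 + b ^ 2 := by
          by_cases ha : a = 0
          · have : b ≠ 0 := fun hb => hab ⟨ha, hb⟩
            positivity
          · positivity
        have := hc 0 a b (by simpa using this)
        simp [this]
    · exact_mod_cast h0
  · intro τ hτ
    have h2 := (hs τ z₁ z₂ hτ).sub (hasSum_ite_eq ((0, 0, 0) : ℕ × ℤ × ℤ) (c 0 0 0))
    refine h2.congr_fun ?_
    rintro ⟨n, a, b⟩
    by_cases hp : ((n, a, b) : ℕ × ℤ × ℤ) = (0, 0, 0)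
    · obtain ⟨rfl, rfl, rfl⟩ : n = 0 ∧ a = 0 ∧ b = 0 := by simpa using hp
      simp [eC_zero]
    · simp only [hp, if_false, sub_zero]
      rw [mul_assoc, ← eC_add]
      congr 2
      push_cast; ring

lemma bd_tt0 : ∃ C : ℝ, 0 ≤ C ∧ ∀ τ : ℂ, 1 ≤ τ.im →
    ‖tt 0 τ 0 - 1‖ ≤ C * Real.exp (-2 * Real.pi * τ.im) := by
  refine bd (fun g : ℤ => if g = 0 then 0 else 1) (fun g => ((g ^ 2 : ℤ) : ℝ)) ?_
    (fun τ => tt 0 τ 0 - 1) ?_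
  · intro g hg
    have hg0 : g ≠ 0 := by rintro rfl; simp at hg
    have : 0 < g ^ 2 := by positivity
    exact_mod_cast this
  · intro τ hτ
    have h2 := (tt_hasSum 0 hτ 0).sub (hasSum_ite_eq (0 : ℤ) (1 : ℂ))
    refine h2.congr_fun ?_
    intro g
    by_cases hp : g = 0
    · simp [hp, eC_zero]
    · simp only [hp, if_false, sub_zero, one_mul]
      congr 1; push_cast; ring

lemma bd_tt1 : ∃ C : ℝ, 0 ≤ C ∧ ∀ τ : ℂ, 1 ≤ τ.im →
    ‖eC (-τ / 4) * tt 1 τ 0 - 1 - 1‖ ≤ C * Real.exp (-2 * Real.pi * τ.im) := by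
  refine bd (fun g : ℤ => if g = 0 ∨ g = -1 then 0 else 1) (fun g => ((g ^ 2 + g : ℤ) : ℝ)) ?_
    (fun τ => eC (-τ / 4) * tt 1 τ 0 - 1 - 1) ?_
  · intro g hg
    have hg0 : ¬ (g = 0 ∨ g = -1) := by
      intro h; simp [h] at hg
    have : 1 ≤ g ^ 2 + g := by
      rcases lt_or_ge g 0 with h | h
      · have : g ≤ -2 := by omega
        nlinarith
      · have : 1 ≤ g := by omega
        nlinarith
    exact_mod_cast this
  · intro τ hτ
    have h2 := (((tt_hasSum 1 hτ 0).mul_left (eC (-τ / 4))).sub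
      (hasSum_ite_eq (0 : ℤ) (1 : ℂ))).sub (hasSum_ite_eq (-1 : ℤ) (1 : ℂ))
    refine h2.congr_fun ?_
    intro g
    rw [← eC_add]
    by_cases hp : g = 0
    · subst hp
      simp
      rw [show -τ / 4 + 4⁻¹ * τ = 0 by ring, eC_zero]; simp
    by_cases hp1 : g = -1
    · subst hp1
      norm_num
      rw [show -τ / 4 + 1 / 4 * τ = 0 by ring, eC_zero, sub_self]
    · simp only [hp, hp1, if_false, sub_zero, one_mul, or_self]
      congr 1; push_cast; ring

lemma exp_small (C ε : ℝ) (hε : 0 < ε) : ∃ B : ℝ, ∀ y, B ≤ y →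
    C * Real.exp (-2 * Real.pi * y) ≤ ε := by
  have h1 : Filter.Tendsto (fun y : ℝ => -2 * Real.pi * y) Filter.atTop Filter.atBot :=
    Filter.tendsto_id.const_mul_atTop_of_neg (by nlinarith [Real.pi_pos])
  have h2 := (Real.tendsto_exp_atBot.comp h1).const_mul C
  rw [mul_zero] at h2
  have h3 := h2.eventually (gt_mem_nhds hε)
  obtain ⟨B, hB⟩ := Filter.eventually_atTop.mp h3
  exact ⟨B, fun y hy => (hB y hy).le⟩

lemma ThZ_zero (τ : ℂ) : ThZ τ 0 0 = 0 := by
  simp [ThZ, Th, mul_comm]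

lemma ThZ_half {τ : ℂ} (h : UHP τ) : ThZ τ (1 / 2) (1 / 2) = 2 * (tt 0 τ 0 * tt 1 τ 0) := by
  have a := tt0_half h 0
  have b := tt1_half h 0
  rw [zero_add] at a b
  unfold ThZ Th
  rw [show ((1:ℂ) / 2 + 1 / 2) / 2 = 1 / 2 by norm_num,
    show Complex.I * ((1:ℂ) / 2 - 1 / 2) / 2 = 0 by norm_num, a, b]
  ring

lemma bounded_f {k : ℕ} {φ : ℂ → ℂ → ℂ → ℂ} (hφ : IsHJF k 1 φ) {f : ℂ → ℂ}
    (hf : ∀ τ z₁ z₂, UHP τ → φ τ z₁ z₂ = f τ * ThZ τ z₁ z₂) :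
    ∃ A B : ℝ, ∀ τ : ℂ, B ≤ τ.im → ‖f τ‖ ≤ A := by
  obtain ⟨c0, hc0⟩ := bd_phi hφ
  have hz : c0 = 0 := by
    by_contra hne
    obtain ⟨C, hC, hb⟩ := hc0 0 0
    obtain ⟨B, hB⟩ := exp_small C (‖c0‖ / 2) (by positivity)
    have hm : 1 ≤ ((max B 1 : ℝ) * Complex.I : ℂ).im := by simp
    have := hb ((max B 1 : ℝ) * Complex.I) hm
    rw [hf _ _ _ (by unfold UHP; linarith), ThZ_zero, mul_zero, zero_sub, norm_neg] at this
    have h2 := hB ((max B 1 : ℝ) * Complex.I : ℂ).im (by simp)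
    have : 0 < ‖c0‖ := by positivity
    linarith
  subst hz
  obtain ⟨C, hC, hb⟩ := hc0 (1 / 2) (1 / 2)
  obtain ⟨C0, -, hb0⟩ := bd_tt0
  obtain ⟨C1, -, hb1⟩ := bd_tt1
  obtain ⟨B0, hB0⟩ := exp_small C0 (1 / 2) (by positivity)
  obtain ⟨B1, hB1⟩ := exp_small C1 1 (by positivity)
  refine ⟨C, max 1 (max B0 B1), fun τ hτ => ?_⟩
  have y1 : 1 ≤ τ.im := (le_max_left _ _).trans hτ
  have y0 : B0 ≤ τ.im := ((le_max_left _ _).trans (le_max_right _ _)).trans hτ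
  have y2 : B1 ≤ τ.im := ((le_max_right _ _).trans (le_max_right _ _)).trans hτ
  have hu : UHP τ := by unfold UHP; linarith
  have k0 := (hb0 τ y1).trans (hB0 _ y0)
  have k1 := (hb1 τ y1).trans (hB1 _ y2)
  have kp := hb τ y1
  rw [sub_zero, hf _ _ _ hu, ThZ_half hu, norm_mul, norm_mul, norm_mul] at kp
  have n0 : 1 / 2 ≤ ‖tt 0 τ 0‖ := by
    have := norm_sub_norm_le (1 : ℂ) (1 - tt 0 τ 0)
    rw [sub_sub_cancel, norm_one, norm_sub_rev 1] at this
    linarith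
  have n1 : 1 ≤ ‖eC (-τ / 4) * tt 1 τ 0‖ := by
    have := norm_sub_norm_le (2 : ℂ) (1 + 1 - eC (-τ / 4) * tt 1 τ 0)
    rw [show (2 : ℂ) - (1 + 1 - eC (-τ / 4) * tt 1 τ 0) = eC (-τ / 4) * tt 1 τ 0 by ring,
      norm_sub_rev (1 + 1), ← sub_sub] at this
    norm_num at this
    norm_num at k1 ⊢
    linarith
  rw [norm_mul, norm_eC] at n1
  have e1 : (-τ / 4).im = - τ.im / 4 := by simp
  rw [e1] at n1
  set E := Real.exp (-2 * Real.pi * (-τ.im / 4)) with hE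
  have hEpos : 0 < E := Real.exp_pos _
  have hle : E * Real.exp (-2 * Real.pi * τ.im) ≤ 1 := by
    rw [hE, ← Real.exp_add, Real.exp_le_one_iff]
    nlinarith [Real.pi_pos]
  have hn2 : ‖(2:ℂ)‖ = 2 := by norm_num
  rw [hn2] at kp
  have q : 1 ≤ E * (2 * (‖tt 0 τ 0‖ * ‖tt 1 τ 0‖)) := by
    nlinarith [norm_nonneg (tt 1 τ 0)]
  calc ‖f τ‖ ≤ ‖f τ‖ * (E * (2 * (‖tt 0 τ 0‖ * ‖tt 1 τ 0‖))) := le_mul_of_one_le_right (norm_nonneg _) q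
    _ = E * (‖f τ‖ * (2 * (‖tt 0 τ 0‖ * ‖tt 1 τ 0‖))) := by ring
    _ ≤ E * (C * Real.exp (-2 * Real.pi * τ.im)) := by gcongr
    _ = C * (E * Real.exp (-2 * Real.pi * τ.im)) := by ring
    _ ≤ C := mul_le_of_le_one_right hC hle

lemma uhp_open : IsOpen {p : ℂ × ℂ × ℂ | UHP p.1} :=
  isOpen_lt continuous_const (Complex.continuous_im.comp continuous_fst)

lemma uhp_open' : IsOpen {τ : ℂ | UHP τ} :=
  isOpen_lt continuous_const Complex.continuous_im

lemma ThZ_ne {τ : ℂ} (h : UHP τ) : ∃ z₁ z₂, ThZ τ z₁ z₂ ≠ 0 := by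
  obtain ⟨w₁, w₂, hw⟩ := Th_ne h
  exact ⟨_, _, by rw [ThZ_W]; exact hw⟩

lemma part1 {k : ℕ} (hk : 0 < k) {φ : ℂ → ℂ → ℂ → ℂ} (hφ : IsHJF k 1 φ) {f : ℂ → ℂ}
    (hf : ∀ τ z₁ z₂, UHP τ → φ τ z₁ z₂ = f τ * ThZ τ z₁ z₂) : IsMFOmegaBar (k - 1) f where
  holo := by
    intro τ hτ
    obtain ⟨z₁, z₂, hz⟩ := ThZ_ne hτ
    have hd1 : DifferentiableAt ℂ (fun t => φ t z₁ z₂) τ := by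
      have := (hφ.holo (τ, z₁, z₂) hτ).differentiableAt (uhp_open.mem_nhds hτ)
      exact DifferentiableAt.comp (x := τ) (f := fun t : ℂ => ((t, z₁, z₂) : ℂ × ℂ × ℂ))
        (g := fun p : ℂ × ℂ × ℂ => φ p.1 p.2.1 p.2.2) this (by fun_prop)
    have hd2 : DifferentiableAt ℂ (fun t => ThZ t z₁ z₂) τ :=
      DifferentiableAt.comp (x := τ) (f := fun t : ℂ => ((t, z₁, z₂) : ℂ × ℂ × ℂ))
        (g := fun p : ℂ × ℂ × ℂ => ThZ p.1 p.2.1 p.2.2) (ThZ_diff hτ z₁ z₂) (by fun_prop)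
    have hd := hd1.div hd2 hz
    refine DifferentiableAt.differentiableWithinAt (hd.congr_of_eventuallyEq ?_)
    filter_upwards [uhp_open'.mem_nhds hτ, hd2.continuousAt.eventually_ne hz] with t ht hne
    simp only [Pi.div_apply]
    rw [hf t z₁ z₂ ht, mul_div_cancel_right₀ _ hne]
  transT := by
    intro τ hτ
    have h1 : UHP (τ + 1) := by simpa [UHP] using hτ
    obtain ⟨z₁, z₂, hz⟩ := ThZ_ne hτ
    have := hφ.transf 1 (by simp) ModularGroup.T τ z₁ z₂ hτ
    simp [Ma, Mb, Mc, Md, ModularGroup.T, eC_zero] at this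
    rw [hf _ _ _ h1, hf _ _ _ hτ, ThZ_T hτ] at this
    apply mul_right_cancel₀ hz
    linear_combination (-Complex.I) * this + (f (τ + 1) * ThZ τ z₁ z₂) * Complex.I_mul_I
  transS := by
    intro τ hτ
    have h0 := uhp_ne hτ
    have h1 := uhp_S hτ
    obtain ⟨z₁, z₂, hz⟩ := ThZ_ne hτ
    have := hφ.transf 1 (by simp) ModularGroup.S τ z₁ z₂ hτ
    simp [Ma, Mb, Mc, Md, ModularGroup.S] at this
    rw [hf _ _ _ h1, hf _ _ _ hτ, ThZ_S hτ] at this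
    apply mul_right_cancel₀ hz
    apply mul_right_cancel₀ (eC_ne (z₁ * z₂ / τ))
    apply mul_left_cancel₀ h0
    obtain ⟨j, rfl⟩ : ∃ j, k = j + 1 := ⟨k - 1, by omega⟩
    rw [Nat.add_sub_cancel]
    rw [pow_succ] at this
    linear_combination (-Complex.I) * this + (f (-1 / τ) * ThZ τ z₁ z₂ * τ * eC (z₁ * z₂ / τ)) * Complex.I_mul_I
  bounded := bounded_f hφ hf

lemma j_ne (M : Matrix.SpecialLinearGroup (Fin 2) ℤ) {τ : ℂ} (h : UHP τ) :
    Mc M * τ + Md M ≠ 0 := by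
  have hd := M.det_coe
  rw [Matrix.det_fin_two] at hd
  intro h0
  have him := congrArg Complex.im h0
  have hre := congrArg Complex.re h0
  simp [Mc, Md] at him hre
  have h' : τ.im ≠ 0 := ne_of_gt h
  have hc : M.1 1 0 = 0 := by
    rcases him with h | h
    · exact_mod_cast h
    · exact absurd h h'
  have hdd : M.1 1 1 = 0 := by
    simp [hc] at hre
    exact_mod_cast hre
  simp [hc, hdd] at hd

lemma Mdet (M : Matrix.SpecialLinearGroup (Fin 2) ℤ) : Ma M * Md M - Mb M * Mc M = 1 := by
  have hd := M.det_coe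
  rw [Matrix.det_fin_two] at hd
  unfold Ma Mb Mc Md
  exact_mod_cast hd

lemma uhp_M (M : Matrix.SpecialLinearGroup (Fin 2) ℤ) {τ : ℂ} (h : UHP τ) :
    UHP ((Ma M * τ + Mb M) / (Mc M * τ + Md M)) := by
  have hj := Complex.normSq_pos.mpr (j_ne M h)
  have hd : ((M.1 0 0 : ℤ) : ℝ) * M.1 1 1 - M.1 0 1 * M.1 1 0 = 1 := by
    have hd := M.det_coe
    rw [Matrix.det_fin_two] at hd
    exact_mod_cast hd
  have h' : 0 < τ.im := h
  unfold UHP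
  rw [Complex.div_im, ← sub_div]
  apply div_pos _ hj
  simp [Ma, Mb, Mc, Md]
  have : 0 < τ.im * (((M.1 0 0 : ℤ) : ℝ) * M.1 1 1 - M.1 0 1 * M.1 1 0) := by rw [hd]; linarith
  linarith

def PM (k : ℕ) (φ : ℂ → ℂ → ℂ → ℂ) (M : Matrix.SpecialLinearGroup (Fin 2) ℤ) : Prop :=
  ∀ τ z₁ z₂ : ℂ, UHP τ →
      φ ((Ma M * τ + Mb M) / (Mc M * τ + Md M)) (z₁ / (Mc M * τ + Md M)) (z₂ / (Mc M * τ + Md M))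
      = (Mc M * τ + Md M) ^ k * eC (Mc M * z₁ * z₂ / (Mc M * τ + Md M)) * φ τ z₁ z₂

lemma PM_one (k : ℕ) (φ : ℂ → ℂ → ℂ → ℂ) : PM k φ 1 := by
  intro τ z₁ z₂ _
  simp [Ma, Mb, Mc, Md, eC_zero]

lemma coc (M N : Matrix.SpecialLinearGroup (Fin 2) ℤ) {τ : ℂ} (h : UHP τ) :
    Mc (M * N) * τ + Md (M * N) = (Mc M * ((Ma N * τ + Mb N) / (Mc N * τ + Md N)) + Md M)
      * (Mc N * τ + Md N) ∧
    Ma (M * N) * τ + Mb (M * N) = (Ma M * ((Ma N * τ + Mb N) / (Mc N * τ + Md N)) + Mb M)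
      * (Mc N * τ + Md N) := by
  have hj := j_ne N h
  have e : Mc (M * N) = Mc M * Ma N + Md M * Mc N := by
    simp [Mc, Ma, Md, Matrix.mul_apply, Fin.sum_univ_two]
  have e2 : Md (M * N) = Mc M * Mb N + Md M * Md N := by
    simp [Mc, Mb, Md, Matrix.mul_apply, Fin.sum_univ_two]
  have e3 : Ma (M * N) = Ma M * Ma N + Mb M * Mc N := by
    simp [Mc, Mb, Ma, Matrix.mul_apply, Fin.sum_univ_two]
  have e4 : Mb (M * N) = Ma M * Mb N + Mb M * Md N := by
    simp [Ma, Mb, Md, Matrix.mul_apply, Fin.sum_univ_two]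
  constructor
  · rw [e, e2]; field_simp; ring
  · rw [e3, e4]; field_simp; ring

lemma coc_exp (M N : Matrix.SpecialLinearGroup (Fin 2) ℤ) {τ : ℂ} (h : UHP τ) (z₁ z₂ : ℂ) :
    Mc (M * N) * z₁ * z₂ / (Mc (M * N) * τ + Md (M * N)) =
     Mc M * (z₁ / (Mc N * τ + Md N)) * (z₂ / (Mc N * τ + Md N))
      / (Mc M * ((Ma N * τ + Mb N) / (Mc N * τ + Md N)) + Md M)
     + Mc N * z₁ * z₂ / (Mc N * τ + Md N) := by
  have hj := j_ne N h
  have hj2 := j_ne M (uhp_M N h)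
  rw [(coc M N h).1]
  have e : Mc (M * N) = Mc M * Ma N + Md M * Mc N := by
    simp [Mc, Ma, Md, Matrix.mul_apply, Fin.sum_univ_two]
  rw [e]
  have hd := Mdet N
  generalize hJ : Mc N * τ + Md N = J at *
  generalize hX : (Ma N * τ + Mb N) = X at *
  have hX2 : Mc N * X = Ma N * J - 1 := by
    rw [← hX, ← hJ]; linear_combination -hd
  generalize hK : Mc M * (X / J) + Md M = K at *
  have hK2 : K * J = Mc M * X + Md M * J := by rw [← hK]; field_simp
  field_simp
  linear_combination (-(Mc N) * z₁ * z₂) * hK2 - (Mc M * z₁ * z₂) * hX2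

lemma PM_mul {k : ℕ} {φ : ℂ → ℂ → ℂ → ℂ} {M N : Matrix.SpecialLinearGroup (Fin 2) ℤ}
    (hM : PM k φ M) (hN : PM k φ N) : PM k φ (M * N) := by
  intro τ z₁ z₂ h
  have hj := j_ne N h
  have hj2 := j_ne M (uhp_M N h)
  have A := hM _ (z₁ / (Mc N * τ + Md N)) (z₂ / (Mc N * τ + Md N)) (uhp_M N h)
  rw [hN τ z₁ z₂ h] at A
  rw [coc_exp M N h, eC_add, (coc M N h).1, (coc M N h).2, mul_div_mul_right _ _ hj, mul_pow]
  rw [div_div, div_div, mul_comm (Mc N * τ + Md N)] at A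
  rw [A]
  ring

lemma PM_inv {k : ℕ} {φ : ℂ → ℂ → ℂ → ℂ} {M : Matrix.SpecialLinearGroup (Fin 2) ℤ}
    (hM : PM k φ M) : PM k φ M⁻¹ := by
  intro τ z₁ z₂ h
  have hj := j_ne M⁻¹ h
  have hj2 := j_ne M (uhp_M M⁻¹ h)
  have A := hM _ (z₁ / (Mc M⁻¹ * τ + Md M⁻¹)) (z₂ / (Mc M⁻¹ * τ + Md M⁻¹)) (uhp_M M⁻¹ h)
  have c1 := (coc M M⁻¹ h).1
  have c2 := (coc M M⁻¹ h).2
  have c3 := coc_exp M M⁻¹ h z₁ z₂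
  rw [mul_inv_cancel] at c1 c2 c3
  have d1 : Mc 1 * τ + Md 1 = 1 := by simp [Mc, Md]
  have d2 : Ma 1 * τ + Mb 1 = τ := by simp [Ma, Mb]
  have d3 : Mc 1 = 0 := by simp [Mc]
  rw [d1] at c1
  rw [d2] at c2
  rw [d1, d3] at c3
  rw [div_div, div_div, mul_comm (Mc M⁻¹ * τ + Md M⁻¹), ← c1, div_one, div_one,
    ← mul_div_mul_right _ _ hj, ← c1, ← c2, div_one] at A
  rw [A]
  have e : eC (Mc M⁻¹ * z₁ * z₂ / (Mc M⁻¹ * τ + Md M⁻¹)) *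
    eC (Mc M * (z₁ / (Mc M⁻¹ * τ + Md M⁻¹)) * (z₂ / (Mc M⁻¹ * τ + Md M⁻¹)) /
      (Mc M * ((Ma M⁻¹ * τ + Mb M⁻¹) / (Mc M⁻¹ * τ + Md M⁻¹)) + Md M)) = 1 := by
    rw [← eC_add, add_comm, ← c3]; simp [eC_zero]
  have e2 : (Mc M⁻¹ * τ + Md M⁻¹) ^ k *
      (Mc M * ((Ma M⁻¹ * τ + Mb M⁻¹) / (Mc M⁻¹ * τ + Md M⁻¹)) + Md M) ^ k = 1 := by
    rw [← mul_pow, mul_comm, ← c1, one_pow]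
  generalize φ ((Ma M⁻¹ * τ + Mb M⁻¹) / (Mc M⁻¹ * τ + Md M⁻¹)) (z₁ / (Mc M⁻¹ * τ + Md M⁻¹)) (z₂ / (Mc M⁻¹ * τ + Md M⁻¹)) = P at *
  generalize (Mc M⁻¹ * τ + Md M⁻¹) ^ k = J1 at *
  generalize (Mc M * ((Ma M⁻¹ * τ + Mb M⁻¹) / (Mc M⁻¹ * τ + Md M⁻¹)) + Md M) ^ k = J2 at *
  generalize eC (Mc M⁻¹ * z₁ * z₂ / (Mc M⁻¹ * τ + Md M⁻¹)) = E1 at *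
  generalize eC (Mc M * (z₁ / (Mc M⁻¹ * τ + Md M⁻¹)) * (z₂ / (Mc M⁻¹ * τ + Md M⁻¹)) /
      (Mc M * ((Ma M⁻¹ * τ + Mb M⁻¹) / (Mc M⁻¹ * τ + Md M⁻¹)) + Md M)) = E2 at *
  linear_combination (-P) * e - P * E1 * E2 * e2

lemma PM_all {k : ℕ} {φ : ℂ → ℂ → ℂ → ℂ} (hS : PM k φ ModularGroup.S)
    (hT : PM k φ ModularGroup.T) (M : Matrix.SpecialLinearGroup (Fin 2) ℤ) : PM k φ M := by
  have hM : M ∈ Subgroup.closure {ModularGroup.S, ModularGroup.T} := by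
    rw [SpecialLinearGroup.SL2Z_generators]; trivial
  induction hM using Subgroup.closure_induction with
  | mem x hx =>
    rcases hx with rfl | hx
    · exact hS
    · rw [Set.mem_singleton_iff] at hx; rw [hx]; exact hT
  | one => exact PM_one k φ
  | mul x y _ _ hx hy => exact PM_mul hx hy
  | inv x _ hx => exact PM_inv hx

lemma phi_transf {k : ℕ} (hk : 0 < k) (hk4 : k % 4 = 2) {f : ℂ → ℂ} (hf : IsMFOmegaBar (k - 1) f) :
    ∀ ε : ℂ, ε ∈ ({1, -1, Complex.I, -Complex.I} : Set ℂ) →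
    ∀ M : Matrix.SpecialLinearGroup (Fin 2) ℤ, ∀ τ z₁ z₂ : ℂ, UHP τ →
      (fun τ z₁ z₂ => f τ * ThZ τ z₁ z₂) ((Ma M * τ + Mb M) / (Mc M * τ + Md M))
        (ε * z₁ / (Mc M * τ + Md M))
        ((starRingEnd ℂ) ε * z₂ / (Mc M * τ + Md M))
      = ε ^ k * (Mc M * τ + Md M) ^ k *
          eC (((1 : ℕ) : ℂ) * Mc M * z₁ * z₂ / (Mc M * τ + Md M)) *
           (fun τ z₁ z₂ => f τ * ThZ τ z₁ z₂) τ z₁ z₂ := by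
  intro ε hε M τ z₁ z₂ h
  have hP : PM k (fun τ z₁ z₂ => f τ * ThZ τ z₁ z₂) M := by
    apply PM_all
    · intro τ z₁ z₂ h
      simp [Ma, Mb, Mc, Md, ModularGroup.S]
      rw [ThZ_S h, hf.transS τ h]
      obtain ⟨j, rfl⟩ : ∃ j, k = j + 1 := ⟨k - 1, by omega⟩
      rw [Nat.add_sub_cancel, pow_succ]
      linear_combination (-(τ ^ j * f τ * τ * eC (z₁ * z₂ / τ) * ThZ τ z₁ z₂)) * Complex.I_mul_I
    · intro τ z₁ z₂ h
      simp [Ma, Mb, Mc, Md, ModularGroup.T, eC_zero]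
      rw [ThZ_T h, hf.transT τ h]
      linear_combination (-(f τ * ThZ τ z₁ z₂)) * Complex.I_mul_I
  rw [hP τ (ε * z₁) ((starRingEnd ℂ) ε * z₂) h]
  have hI : Complex.I ^ k = -1 := by
    rw [← Nat.div_add_mod k 4, hk4, pow_add, pow_mul, Complex.I_pow_four]; simp
  have he : Even k := ⟨k / 2, by omega⟩
  have hn : ε * (starRingEnd ℂ) ε = 1 := by
    rcases hε with rfl | rfl | rfl | rfl <;> simp
  have hr : ThZ τ (ε * z₁) ((starRingEnd ℂ) ε * z₂) = ε ^ k * ThZ τ z₁ z₂ := by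
    rcases hε with rfl | rfl | rfl | rfl
    · simp
    · simpa [he.neg_one_pow] using ThZ_neg h z₁ z₂
    · simpa [hI] using ThZ_rot h z₁ z₂
    · rw [he.neg_pow, hI]
      have := ThZ_rot h (-z₁) (-z₂)
      rw [ThZ_neg h] at this
      simpa using this
  simp only [hr]
  rw [show Mc M * (ε * z₁) * ((starRingEnd ℂ) ε * z₂) = ((1:ℕ):ℂ) * Mc M * z₁ * z₂ by
    rw [Nat.cast_one]; linear_combination (Mc M * z₁ * z₂) * hn]
  ring

lemma fourier_f {w : ℕ} {f : ℂ → ℂ} (hf : IsMFOmegaBar w f) : ∃ a : ℕ → ℂ, a 0 = 0 ∧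
    ∀ τ, UHP τ → HasSum (fun n : ℕ => a n * eC (n * τ)) (f τ * eC (τ / 4)) := by
  classical
  let G : ℂ → ℂ := fun τ => if 0 < τ.im then f τ * eC (τ / 4) else 0
  have hG : ∀ τ, 0 < τ.im → G τ = f τ * eC (τ / 4) := fun τ h => if_pos h
  have hper : Function.Periodic G ((1 : ℝ) : ℂ) := by
    intro τ
    by_cases h : 0 < τ.im
    · have h1 : 0 < (τ + ((1 : ℝ) : ℂ)).im := by simpa using h
      rw [hG _ h, hG _ h1, Complex.ofReal_one, hf.transT τ h, add_div, eC_add, eC_quarter]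
      linear_combination (-(f τ * eC (τ / 4))) * Complex.I_mul_I
    · have h1 : ¬ 0 < (τ + ((1 : ℝ) : ℂ)).im := by simpa using h
      simp only [G, if_neg h, if_neg h1]
  have hdiff : ∀ τ, 0 < τ.im → DifferentiableAt ℂ G τ := by
    intro τ h
    have ho : {τ : ℂ | 0 < τ.im} ∈ nhds τ :=
      (isOpen_lt continuous_const Complex.continuous_im).mem_nhds h
    have h1 : DifferentiableAt ℂ (fun τ => f τ * eC (τ / 4)) τ := by
      refine (hf.holo.differentiableAt ho).mul ?_
      unfold eC; fun_prop
    refine h1.congr_of_eventuallyEq ?_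
    filter_upwards [ho] with x hx using hG x hx
  have hev : ∀ᶠ z in Filter.comap Complex.im Filter.atTop, DifferentiableAt ℂ G z :=
    Filter.mem_of_superset (Filter.preimage_mem_comap (Filter.Ioi_mem_atTop (0 : ℝ)))
      (fun z hz => hdiff z hz)
  have hzero : Filter.ZeroAtFilter (Filter.comap Complex.im Filter.atTop) G := by
    obtain ⟨A, B, hAB⟩ := hf.bounded
    have hlim : Filter.Tendsto (fun z : ℂ => A * Real.exp (-(Real.pi / 2 * z.im)))
        (Filter.comap Complex.im Filter.atTop) (nhds (A * 0)) := by
      refine Filter.Tendsto.const_mul A ?_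
      refine (Real.tendsto_exp_neg_atTop_nhds_zero.comp
        (Filter.tendsto_id.const_mul_atTop (by positivity : 0 < Real.pi / 2))).comp
        Filter.tendsto_comap
    rw [mul_zero] at hlim
    refine squeeze_zero_norm' ?_ hlim
    refine Filter.mem_of_superset (Filter.preimage_mem_comap
      (Filter.inter_mem (Filter.Ioi_mem_atTop (0 : ℝ)) (Filter.Ici_mem_atTop B))) ?_
    rintro z ⟨hz1, hz2⟩
    change ‖G z‖ ≤ _
    rw [hG z hz1, norm_mul, norm_eC]
    have : -2 * Real.pi * (z / 4).im = -(Real.pi / 2 * z.im) := by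
      rw [show (z / 4).im = z.im / 4 by simp]; ring
    rw [this]
    exact mul_le_mul_of_nonneg_right (hAB z hz2) (Real.exp_pos _).le
  let F := Function.Periodic.cuspFunction 1 G
  have hF0 : F 0 = 0 := Function.Periodic.cuspFunction_zero_of_zero_at_inf one_pos hzero
  have hFd : DifferentiableOn ℂ F (Metric.ball 0 1) := by
    intro q hq
    refine DifferentiableAt.differentiableWithinAt ?_
    by_cases h0 : q = 0
    · rw [h0]
      exact Function.Periodic.differentiableAt_cuspFunction_zero one_pos hper hev
        hzero.boundedAtFilter
    · have hq1 : ‖q‖ < 1 := by simpa using hq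
      have him : 0 < (Function.Periodic.invQParam 1 q).im := by
        rw [Function.Periodic.im_invQParam]
        have := Real.log_neg (norm_pos_iff.mpr h0) hq1
        have hp : (-1 : ℝ) / (2 * Real.pi) < 0 := div_neg_of_neg_of_pos (by norm_num) (by positivity)
        exact mul_pos_of_neg_of_neg hp this
      have := Function.Periodic.differentiableAt_cuspFunction one_ne_zero hper (hdiff _ him)
      rwa [Function.Periodic.qParam_right_inv one_ne_zero h0] at this
  refine ⟨fun n => ((n.factorial : ℂ))⁻¹ * iteratedDeriv n F 0, by simp [hF0], ?_⟩
  intro τ hτ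
  have hb : Function.Periodic.qParam 1 τ ∈ Metric.ball (0 : ℂ) 1 := by
    simpa using Function.Periodic.norm_qParam_lt_one one_pos hτ
  have hs := Complex.hasSum_taylorSeries_on_ball hFd hb
  rw [show F (Function.Periodic.qParam 1 τ) = f τ * eC (τ / 4) from
    (Function.Periodic.eq_cuspFunction one_ne_zero hper τ).trans (hG τ hτ)] at hs
  refine hs.congr_fun ?_
  intro n
  have : eC (n * τ) = Function.Periodic.qParam 1 τ ^ n := by
    unfold eC Function.Periodic.qParam
    rw [← Complex.exp_nat_mul]
    congr 1
    simp
    ring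
  rw [this, sub_zero, smul_eq_mul, smul_eq_mul]
  ring

open Classical in
def chi (r s : ℤ) : ℂ := (if Even r ∧ Odd s then 1 else 0) - (if Odd r ∧ Even s then 1 else 0)

lemma chi1 (a b : ℤ) (E : ℤ × ℤ → ℂ) (S : ℂ)
    (h : HasSum (fun g : ℤ × ℤ => E (a + 2 * g.1, b + 2 * g.2)) S) :
    HasSum (fun p : ℤ × ℤ => (if p.1 % 2 = a % 2 ∧ p.2 % 2 = b % 2 then 1 else 0) * E p) S := by
  have hi : Function.Injective (fun g : ℤ × ℤ => (a + 2 * g.1, b + 2 * g.2)) := by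
    intro x y hxy
    simp only [Prod.mk.injEq] at hxy
    ext <;> omega
  refine (hi.hasSum_iff ?_).mp (h.congr_fun ?_)
  · intro p hp
    rw [if_neg, zero_mul]
    rintro ⟨h1, h2⟩
    apply hp
    refine ⟨((p.1 - a) / 2, (p.2 - b) / 2), ?_⟩
    ext <;> simp <;> omega
  · intro g
    simp only [Function.comp]
    rw [if_pos, one_mul]
    constructor <;> omega

lemma Th_hasSum {τ : ℂ} (h : UHP τ) (u v : ℂ) : HasSum (fun p : ℤ × ℤ => chi p.1 p.2 *
    eC (((p.1 : ℂ) ^ 2 + (p.2 : ℂ) ^ 2) / 4 * τ + p.1 * u + p.2 * v)) (Th τ u v) := by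
  have A : ∀ a b : ℤ, HasSum (fun p : ℤ × ℤ => (if p.1 % 2 = a % 2 ∧ p.2 % 2 = b % 2 then 1 else 0) *
    eC (((p.1 : ℂ) ^ 2 + (p.2 : ℂ) ^ 2) / 4 * τ + p.1 * u + p.2 * v)) (tt a τ u * tt b τ v) := by
    intro a b
    refine chi1 a b (fun p => eC (((p.1 : ℂ) ^ 2 + (p.2 : ℂ) ^ 2) / 4 * τ + p.1 * u + p.2 * v)) _
      ((tt2_hasSum a b h u v).congr_fun ?_)
    intro g
    rw [← eC_add]
    congr 1
    push_cast
    ring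
  refine ((A 0 1).sub (A 1 0)).congr_fun ?_
  intro p
  rw [chi, ← sub_mul]
  simp only [Int.even_iff, Int.odd_iff]
  norm_num

def MM (r s : ℤ) : ℕ := ((r ^ 2 + s ^ 2 - 1) / 4).toNat

lemma chi_MM {r s : ℤ} (h : chi r s ≠ 0) : r ^ 2 + s ^ 2 = 4 * (MM r s : ℤ) + 1 := by
  have hp : (Even r ∧ Odd s) ∨ (Odd r ∧ Even s) := by
    by_contra hn
    push Not at hn
    apply h
    unfold chi
    rw [if_neg (fun h => hn.1 h.1 h.2), if_neg (fun h => hn.2 h.1 h.2), sub_zero]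
  have : ∃ m : ℤ, 0 ≤ m ∧ r ^ 2 + s ^ 2 = 4 * m + 1 := by
    rcases hp with ⟨⟨x, rfl⟩, ⟨y, rfl⟩⟩ | ⟨⟨y, rfl⟩, ⟨x, rfl⟩⟩
    · refine ⟨x ^ 2 + y ^ 2 + y, ?_, by ring⟩
      have : 0 ≤ y ^ 2 + y := by
        rcases le_or_gt 0 y with h | h <;> nlinarith
      nlinarith [sq_nonneg x]
    · refine ⟨x ^ 2 + y ^ 2 + y, ?_, by ring⟩
      have : 0 ≤ y ^ 2 + y := by
        rcases le_or_gt 0 y with h | h <;> nlinarith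
      nlinarith [sq_nonneg x]
  obtain ⟨m, hm, he⟩ := this
  unfold MM
  rw [he]
  omega

lemma fourier_prod {f : ℂ → ℂ} {a : ℕ → ℂ} (a0 : a 0 = 0)
    (ha : ∀ τ, UHP τ → HasSum (fun n : ℕ => a n * eC (n * τ)) (f τ * eC (τ / 4))) :
    ∃ c : ℕ → ℤ → ℤ → ℂ,
      (∀ (n : ℕ) (a b : ℤ), 4 * (n : ℤ) < a ^ 2 + b ^ 2 → c n a b = 0) ∧
      ∀ τ u v : ℂ, UHP τ →
        HasSum (fun p : ℕ × ℤ × ℤ => c p.1 p.2.1 p.2.2 *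
          eC ((p.1 : ℂ) * τ + p.2.1 * u + p.2.2 * v)) (f τ * Th τ u v) := by
  refine ⟨fun n r s => chi r s * (if MM r s ≤ n then a (n - MM r s) else 0), ?_, ?_⟩
  · intro n r s h
    simp only
    by_cases hc : chi r s = 0
    · rw [hc, zero_mul]
    · have := chi_MM hc
      have hle : n ≤ MM r s := by omega
      split_ifs with h2
      · rw [show n - MM r s = 0 by omega, a0, mul_zero]
      · rw [mul_zero]
  · intro τ u v h
    have h1 := hasSum_mulC (ha τ h) (Th_hasSum h u v)
    have h2 := h1.mul_left (eC (-(τ / 4)))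
    have e : eC (-(τ / 4)) * (f τ * eC (τ / 4) * Th τ u v) = f τ * Th τ u v := by
      rw [eC_neg]
      have := eC_ne (τ / 4)
      field_simp
    rw [e] at h2
    have hi : Function.Injective (fun g : ℕ × ℤ × ℤ => (g.1 + MM g.2.1 g.2.2, g.2)) := by
      intro x y hxy
      simp only [Prod.mk.injEq] at hxy
      obtain ⟨e1, e2⟩ := hxy
      rw [e2] at e1
      ext
      · omega
      · rw [e2]
      · rw [e2]
    refine (hi.hasSum_iff ?_).mp (h2.congr_fun ?_)
    · intro p hp
      beta_reduce
      rw [if_neg, mul_zero, zero_mul]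
      intro hle
      exact hp ⟨(p.1 - MM p.2.1 p.2.2, p.2), by ext <;> simp; omega⟩
    · rintro ⟨n, r, s⟩
      simp only [Function.comp]
      rw [if_pos (Nat.le_add_left _ _), Nat.add_sub_cancel]
      by_cases hc : chi r s = 0
      · rw [hc]; ring
      · have hm := chi_MM hc
        have hm' : (r : ℂ) ^ 2 + (s : ℂ) ^ 2 = 4 * (MM r s : ℂ) + 1 := by exact_mod_cast hm
        have : eC (((n + MM r s : ℕ) : ℂ) * τ + r * u + s * v) = eC (-(τ / 4)) * (eC (n * τ) *
            eC (((r : ℂ) ^ 2 + (s : ℂ) ^ 2) / 4 * τ + r * u + s * v)) := by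
          rw [← eC_add, ← eC_add, hm']
          congr 1
          push_cast
          ring
        rw [this]
        ring

lemma phi_hjf {k : ℕ} (hk : 0 < k) (hk4 : k % 4 = 2) {f : ℂ → ℂ} (hf : IsMFOmegaBar (k - 1) f) :
    IsHJF k 1 (fun τ z₁ z₂ => f τ * ThZ τ z₁ z₂) where
  holo := by
    rintro ⟨τ, z₁, z₂⟩ hp
    have hτ : UHP τ := hp
    refine DifferentiableAt.differentiableWithinAt ?_
    refine DifferentiableAt.mul ?_ (ThZ_diff hτ z₁ z₂)
    have ho : {τ : ℂ | UHP τ} ∈ nhds τ :=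
      (isOpen_lt continuous_const Complex.continuous_im).mem_nhds hτ
    exact DifferentiableAt.comp (x := ((τ, z₁, z₂) : ℂ × ℂ × ℂ)) (g := f)
      (f := fun p : ℂ × ℂ × ℂ => p.1) (hf.holo.differentiableAt ho) (by fun_prop)
  transf := phi_transf hk hk4 hf
  ellip := by
    intro p q u v τ z₁ z₂ h
    rw [ThZ_ellip p q u v h, Nat.cast_one, neg_one_mul]
    ring
  fourier := by
    obtain ⟨a, a0, ha⟩ := fourier_f hf
    obtain ⟨c, hc, hs⟩ := fourier_prod a0 ha
    refine ⟨c, fun n x y h => hc n x y (by simpa using h), ?_⟩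
    intro τ z₁ z₂ h
    refine (hs τ ((z₁ + z₂) / 2) (Complex.I * (z₁ - z₂) / 2) h).congr_fun ?_
    intro p
    congr 2
    ring

open Classical in
def hcomp (f : ℂ → ℂ) (a b : ℤ) (τ : ℂ) : ℂ :=
  if a % 2 = 0 ∧ b % 2 = 1 then f τ else if a % 2 = 1 ∧ b % 2 = 0 then - f τ else 0

lemma hcomp_dec (f : ℂ → ℂ) : HasThetaDecomp 1 (fun τ z₁ z₂ => f τ * ThZ τ z₁ z₂) (hcomp f) := by
  constructor
  · intro a b τ
    simp [hcomp]
  · intro τ z₁ z₂ hτ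
    simp only [thetaH_eq _ _ hτ, Finset.sum_range_succ, Finset.sum_range_zero,
      mul_one, Nat.cast_zero, Nat.cast_one, zero_add]
    simp only [hcomp, ThZ, Th]
    norm_num
    ring

/-- for `k ≡ 2 (mod 4)`, `φ ↦ h_{0,1}` (the theta component at `s = i/2`)
is an isomorphism `J_{k,1}(O_K) ≅ M_{k-1}(SL(2,ℤ), ω̄)`. -/
theorem stmt2 (k : ℕ) (hk : 0 < k) (hk4 : k % 4 = 2) :
    (∀ (φ : ℂ → ℂ → ℂ → ℂ) (h : ℤ → ℤ → ℂ → ℂ),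
      IsHJF k 1 φ → HasThetaDecomp 1 φ h → IsMFOmegaBar (k - 1) (h 0 1)) ∧
    (∀ (φ φ' : ℂ → ℂ → ℂ → ℂ) (h h' : ℤ → ℤ → ℂ → ℂ),
      IsHJF k 1 φ → IsHJF k 1 φ' → HasThetaDecomp 1 φ h → HasThetaDecomp 1 φ' h' →
      (∀ τ : ℂ, UHP τ → h 0 1 τ = h' 0 1 τ) →
      ∀ τ z₁ z₂ : ℂ, UHP τ → φ τ z₁ z₂ = φ' τ z₁ z₂) ∧
    (∀ f : ℂ → ℂ, IsMFOmegaBar (k - 1) f →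
      ∃ (φ : ℂ → ℂ → ℂ → ℂ) (h : ℤ → ℤ → ℂ → ℂ),
        IsHJF k 1 φ ∧ HasThetaDecomp 1 φ h ∧ ∀ τ : ℂ, UHP τ → h 0 1 τ = f τ) := by
  refine ⟨?_, ?_, ?_⟩
  · intro φ h hφ hd
    exact part1 hk hφ (fun τ z₁ z₂ hτ => decomp hk4 hφ hd hτ z₁ z₂)
  · intro φ φ' h h' hφ hφ' hd hd' he τ z₁ z₂ hτ
    rw [decomp hk4 hφ hd hτ, decomp hk4 hφ' hd' hτ, he τ hτ]
  · intro f hf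
    refine ⟨_, _, phi_hjf hk hk4 hf, hcomp_dec f, ?_⟩
    intro τ _
    simp [hcomp]
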